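/- Fix an o-minimal structure on the real field and definable (not necessarily continuous) vector fields X₁,…,X_r : ℝⁿ → ℝⁿ. If A ⊆ ℝⁿ is closed and definable, then the C¹-Zariski tangent set TA = {(x,v) : x ∈ A, v ∈ T_xA} is a definable subset of ℝ²ⁿ, and consequently char(A) = {x ∈ A : X_j(x) ∈ T_xA for all j} is definable. -/

import Mathlib

/-- A structure on the ordered field of real numbers: a family of boolean algebras of
subsets of `ℝⁿ`, closed under products and coordinate projections, and containing all
semialgebraic sets (generated by polynomial equalities and inequalities). -/
structure RealStructure where
  defin : (n : ℕ) → Set (Set (Fin n → ℝ))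
  empty_mem : ∀ n, ∅ ∈ defin n
  union_mem : ∀ {n : ℕ} {A B : Set (Fin n → ℝ)}, A ∈ defin n → B ∈ defin n → A ∪ B ∈ defin n
  compl_mem : ∀ {n : ℕ} {A : Set (Fin n → ℝ)}, A ∈ defin n → Aᶜ ∈ defin n
  prod_mem : ∀ {n m : ℕ} {A : Set (Fin n → ℝ)} {B : Set (Fin m → ℝ)},
    A ∈ defin n → B ∈ defin m →
    {x : Fin (n + m) → ℝ | (fun i => x (Fin.castAdd m i)) ∈ A ∧
      (fun i => x (Fin.natAdd n i)) ∈ B} ∈ defin (n + m)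
  proj_mem : ∀ {n : ℕ} {A : Set (Fin (n + 1) → ℝ)}, A ∈ defin (n + 1) →
    {x : Fin n → ℝ | ∃ t : ℝ, Fin.snoc x t ∈ A} ∈ defin n
  polyEq_mem : ∀ {n : ℕ} (p : MvPolynomial (Fin n) ℝ),
    {x : Fin n → ℝ | MvPolynomial.eval x p = 0} ∈ defin n
  polyLt_mem : ∀ {n : ℕ} (p : MvPolynomial (Fin n) ℝ),
    {x : Fin n → ℝ | 0 < MvPolynomial.eval x p} ∈ defin n

/-- An o-minimal structure: a structure on the real field in which every definable
subset of `ℝ` is a finite union of points and open intervals (equivalently, has finite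
frontier). -/
structure OMinimalStructure extends RealStructure where
  o_minimal : ∀ {A : Set (Fin 1 → ℝ)}, A ∈ defin 1 →
    (frontier {t : ℝ | (fun _ : Fin 1 => t) ∈ A}).Finite

/-- A map `f : ℝⁿ → ℝᵐ` is definable if its graph is a definable subset of `ℝ^{n+m}`. -/
def DefinableFun (S : RealStructure) {n m : ℕ} (f : (Fin n → ℝ) → (Fin m → ℝ)) : Prop :=
  {z : Fin (n + m) → ℝ |
    (fun i => z (Fin.natAdd n i)) = f (fun i => z (Fin.castAdd m i))} ∈ S.defin (n + m)

/-- The C¹-Zariski tangent bundle `TA` of `A ⊆ ℝⁿ`, as a subset of `ℝ^{n+n}`. -/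
def zariskiTangentSet {n : ℕ} (A : Set (Fin n → ℝ)) : Set (Fin (n + n) → ℝ) :=
  {z | (fun i => z (Fin.castAdd n i)) ∈ A ∧
    ∀ f : (Fin n → ℝ) → ℝ, ContDiff ℝ 1 f → (∀ x ∈ A, f x = 0) →
      fderiv ℝ f (fun i => z (Fin.castAdd n i)) (fun i => z (Fin.natAdd n i)) = 0}

section MichaelSelection

open Set Filter Topology

variable {X V : Type*} [TopologicalSpace X] [NormalSpace X] [ParacompactSpace X]
  [NormedAddCommGroup V] [NormedSpace ℝ V]

/-- Lower hemicontinuity of a set-valued map into a normed space, in metric form. -/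
def LowerHemi (Φ : X → Set V) : Prop :=
  ∀ x, ∀ v ∈ Φ x, ∀ ε > 0, ∀ᶠ y in 𝓝 x, ∃ w ∈ Φ y, dist w v < ε

/-- Refinement of an approximate continuous selection of a lower hemicontinuous convex-valued
map. -/
theorem LowerHemi.exists_refined_selection {Φ : X → Set V} (hΦ : LowerHemi Φ)
    (hconv : ∀ x, Convex ℝ (Φ x)) {g : X → V} (hg : Continuous g) {r ε : ℝ} (hε : 0 < ε)
    (hgr : ∀ x, ∃ v ∈ Φ x, dist v (g x) < r) :
    ∃ h : X → V, Continuous h ∧ ∀ x, (∃ v ∈ Φ x, dist v (h x) < ε) ∧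
      dist (g x) (h x) < r + ε := by
  obtain ⟨h, hh⟩ := exists_continuous_forall_mem_convex_of_local_const
    (t := fun x => Metric.thickening ε (Φ x ∩ Metric.ball (g x) r))
    (fun x => ((hconv x).inter (convex_ball _ _)).thickening ε) (by
      intro x
      obtain ⟨v, hv, hvr⟩ := hgr x
      refine ⟨v, ?_⟩
      have hs : 0 < (r - dist v (g x)) / 2 := by linarith
      filter_upwards [hΦ x v hv (min ε ((r - dist v (g x)) / 2)) (lt_min hε hs),
        hg.continuousAt.eventually (Metric.ball_mem_nhds (g x) hs)] with y ⟨w, hw, hwv⟩ hy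
      rw [Metric.mem_thickening_iff]
      refine ⟨w, ⟨hw, ?_⟩, ?_⟩
      · have h1 := hwv.trans_le (min_le_right _ _)
        have h2 : dist (g y) (g x) < (r - dist v (g x)) / 2 := hy
        have h3 := dist_triangle4 w v (g x) (g y)
        rw [dist_comm (g x) (g y)] at h3
        rw [Metric.mem_ball]
        linarith
      · rw [dist_comm]
        exact hwv.trans_le (min_le_left _ _))
  refine ⟨h, h.continuous, fun x => ?_⟩
  obtain ⟨w, ⟨hw, hwr⟩, hwε⟩ := Metric.mem_thickening_iff.1 (hh x)
  rw [Metric.mem_ball, dist_comm] at hwr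
  rw [dist_comm] at hwε
  exact ⟨⟨w, hw, hwε⟩, (dist_triangle _ _ _).trans_lt (add_lt_add hwr hwε)⟩

/-- **Michael's selection theorem**. -/
theorem LowerHemi.exists_continuous_selection [CompleteSpace V] {Φ : X → Set V}
    (hΦ : LowerHemi Φ) (hconv : ∀ x, Convex ℝ (Φ x)) (hne : ∀ x, (Φ x).Nonempty)
    (hclosed : ∀ x, IsClosed (Φ x)) :
    ∃ g : X → V, Continuous g ∧ ∀ x, g x ∈ Φ x := by
  obtain ⟨g₀, hg₀⟩ := exists_continuous_forall_mem_convex_of_local_const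
    (t := fun x => Metric.thickening 1 (Φ x))
    (fun x => (hconv x).thickening 1) (by
      intro x
      obtain ⟨v, hv⟩ := hne x
      refine ⟨v, ?_⟩
      filter_upwards [hΦ x v hv 1 one_pos] with y ⟨w, hw, hwv⟩
      rw [Metric.mem_thickening_iff]
      exact ⟨w, hw, by rwa [dist_comm]⟩)
  let P : ℕ → (X → V) → Prop := fun k g =>
    Continuous g ∧ ∀ x, ∃ v ∈ Φ x, dist v (g x) < (1 / 2 : ℝ) ^ k
  have h0 : P 0 g₀ := ⟨g₀.continuous, fun x => by
    obtain ⟨w, hw, hwx⟩ := Metric.mem_thickening_iff.1 (hg₀ x)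
    exact ⟨w, hw, by rwa [pow_zero, dist_comm]⟩⟩
  have hstep : ∀ k g, P k g → ∃ h, P (k + 1) h ∧
      ∀ x, dist (g x) (h x) ≤ 2 * (1 / 2 : ℝ) ^ k := by
    rintro k g ⟨hg, hgr⟩
    obtain ⟨h, hh, hhr⟩ := hΦ.exists_refined_selection hconv hg
      (pow_pos (by norm_num : (0 : ℝ) < 1 / 2) (k + 1)) hgr
    refine ⟨h, ⟨hh, fun x => (hhr x).1⟩, fun x => (hhr x).2.le.trans ?_⟩
    have : (0 : ℝ) < (1 / 2) ^ k := by positivity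
    rw [pow_succ]
    linarith
  choose! s hs using hstep
  let G : ℕ → X → V := fun k => Nat.rec g₀ (fun k g => s k g) k
  have hG : ∀ k, P k (G k) := fun k => by
    induction k with
    | zero => exact h0
    | succ k ih => exact (hs k (G k) ih).1
  have hd : ∀ x k, dist (G k x) (G (k + 1) x) ≤ 2 * (1 / 2 : ℝ) ^ k := fun x k =>
    (hs k (G k) (hG k)).2 x
  have hlim : ∀ x, ∃ v, Tendsto (fun k => G k x) atTop (𝓝 v) := fun x =>
    cauchySeq_tendsto_of_complete (cauchySeq_of_le_geometric _ _ (by norm_num) (hd x))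
  choose g hg using hlim
  have hpow : Tendsto (fun k : ℕ => (1 / 2 : ℝ) ^ k) atTop (𝓝 0) :=
    tendsto_pow_atTop_nhds_zero_of_lt_one (by norm_num) (by norm_num)
  refine ⟨g, ?_, fun x => ?_⟩
  · have hunif : TendstoUniformly G g atTop := by
      rw [Metric.tendstoUniformly_iff]
      intro ε hε
      have h4 : Tendsto (fun k : ℕ => 2 * (1 / 2 : ℝ) ^ k / (1 - 1 / 2)) atTop (𝓝 0) := by
        simpa using (hpow.const_mul 2).div_const (1 - 1 / 2)
      filter_upwards [h4.eventually (gt_mem_nhds hε)] with k hk x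
      rw [dist_comm]
      exact (dist_le_of_le_geometric_of_tendsto _ _ (by norm_num) (hd x) (hg x) k).trans_lt hk
    exact hunif.continuous (Frequently.of_forall fun k => (hG k).1)
  · choose v hv hvG using fun k => (hG k).2 x
    refine (hclosed x).mem_of_tendsto (b := atTop) (f := v) ?_ (Eventually.of_forall hv)
    exact (tendsto_iff_of_dist (squeeze_zero (fun _ => dist_nonneg) (fun k => (hvG k).le) hpow)).2
      (hg x)

end MichaelSelection

section BundleRefinement

open Set Filter Topology Module

variable {X V : Type*} [TopologicalSpace X] [NormedAddCommGroup V] [NormedSpace ℝ V]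

/-- The Glaeser refinement of a bundle of linear subspaces over `A`: a vector of the fibre at `x`
is kept if it is approximated by vectors of the fibres at nearby points of `A`. -/
def glaeserRefine (A : Set X) (N : X → Submodule ℝ V) (x : X) : Submodule ℝ V where
  carrier := {v | v ∈ N x ∧ ∀ ε > 0, ∀ᶠ y in 𝓝[A] x, ∃ w ∈ N y, dist w v < ε}
  zero_mem' := ⟨zero_mem _, fun ε hε => Eventually.of_forall fun y => ⟨0, zero_mem _, by simpa⟩⟩
  add_mem' := by
    rintro v v' ⟨hv, h⟩ ⟨hv', h'⟩
    refine ⟨add_mem hv hv', fun ε hε => ?_⟩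
    filter_upwards [h _ (half_pos hε), h' _ (half_pos hε)] with y ⟨w, hw, hwv⟩ ⟨w', hw', hwv'⟩
    exact ⟨w + w', add_mem hw hw',
      (dist_add_add_le _ _ _ _).trans_lt (by linarith)⟩
  smul_mem' := by
    rintro c v ⟨hv, h⟩
    refine ⟨Submodule.smul_mem _ c hv, fun ε hε => ?_⟩
    have hc : 0 < ‖c‖ + 1 := by positivity
    filter_upwards [h (ε / (‖c‖ + 1)) (div_pos hε hc)] with y ⟨w, hw, hwv⟩
    refine ⟨c • w, Submodule.smul_mem _ c hw, ?_⟩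
    rw [lt_div_iff₀ hc] at hwv
    rw [dist_smul₀]
    nlinarith [dist_nonneg (x := w) (y := v)]

theorem mem_glaeserRefine {A : Set X} {N : X → Submodule ℝ V} {x : X} {v : V} :
    v ∈ glaeserRefine A N x ↔
      v ∈ N x ∧ ∀ ε > 0, ∀ᶠ y in 𝓝[A] x, ∃ w ∈ N y, dist w v < ε := Iff.rfl

theorem glaeserRefine_le (A : Set X) (N : X → Submodule ℝ V) (x : X) :
    glaeserRefine A N x ≤ N x := fun _ h => h.1

theorem glaeserRefine_congr {A : Set X} {N N' : X → Submodule ℝ V} {x : X} (hx : x ∈ A)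
    (h : ∀ᶠ y in 𝓝[A] x, N y = N' y) : glaeserRefine A N x = glaeserRefine A N' x := by
  ext v
  rw [mem_glaeserRefine, mem_glaeserRefine, h.self_of_nhdsWithin hx]
  refine and_congr_right fun _ => forall₂_congr fun ε _ => eventually_congr ?_
  filter_upwards [h] with y hy
  rw [hy]

theorem finrank_glaeserRefine_le [FiniteDimensional ℝ V] (A : Set X) (N : X → Submodule ℝ V)
    (x : X) : ∀ᶠ y in 𝓝[A] x, finrank ℝ (glaeserRefine A N x) ≤ finrank ℝ (N y) := by
  let b := finBasis ℝ (glaeserRefine A N x)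
  let f : Fin (finrank ℝ (glaeserRefine A N x)) → V := fun i => b i
  have hf : LinearIndependent ℝ f :=
    b.linearIndependent.map' (Submodule.subtype _) (Submodule.ker_subtype _)
  obtain ⟨ε, hε, hball⟩ := Metric.eventually_nhds_iff.1 hf.eventually
  filter_upwards [eventually_all.2 fun i => (b i).2.2 ε hε] with y hy
  choose w hw hwf using hy
  have hli : LinearIndependent ℝ w := hball ((dist_pi_lt_iff hε).2 hwf)
  have hli' : LinearIndependent ℝ fun i => (⟨w i, hw i⟩ : N y) :=
    LinearIndependent.of_comp (N y).subtype hli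
  simpa using hli'.fintype_card_le_finrank

/-- The iterated Glaeser refinements of a bundle. -/
def glaeserIter (A : Set X) (N : X → Submodule ℝ V) : ℕ → X → Submodule ℝ V
  | 0 => N
  | k + 1 => glaeserRefine A (glaeserIter A N k)

theorem glaeserIter_antitone (A : Set X) (N : X → Submodule ℝ V) (x : X) :
    Antitone fun k => glaeserIter A N k x :=
  antitone_nat_of_succ_le fun k => glaeserRefine_le A (glaeserIter A N k) x

theorem glaeserIter_eq_of_eventually {A : Set X} {N : X → Submodule ℝ V} {x : X} (hx : x ∈ A)
    {k : ℕ} (h : ∀ᶠ y in 𝓝[A] x, glaeserIter A N (k + 1) y = glaeserIter A N k y) {l : ℕ}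
    (hl : k ≤ l) : glaeserIter A N l x = glaeserIter A N k x := by
  have key : ∀ m, ∀ᶠ y in 𝓝[A] x, glaeserIter A N (k + m + 1) y = glaeserIter A N (k + m) y := by
    intro m
    induction m with
    | zero => exact h
    | succ m ih =>
      filter_upwards [eventually_eventually_nhdsWithin.2 ih, self_mem_nhdsWithin] with y hy hyA
      exact glaeserRefine_congr hyA hy
  obtain ⟨m, rfl⟩ := Nat.exists_eq_add_of_le hl
  clear hl
  induction m with
  | zero => rfl
  | succ m ih => exact ((key m).self_of_nhdsWithin hx).trans ih

theorem glaeserIter_eq_of_finrank [FiniteDimensional ℝ V] (A : Set X) (N : X → Submodule ℝ V)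
    (k : ℕ) : ∀ x ∈ A, finrank ℝ V ≤ finrank ℝ (glaeserIter A N (2 * k + 1) x) + k →
      ∀ l, 2 * k + 1 ≤ l → glaeserIter A N l x = glaeserIter A N (2 * k + 1) x := by
  induction k with
  | zero =>
    intro x hx hdim l hl
    refine glaeserIter_eq_of_eventually hx ?_ hl
    have h1 := finrank_glaeserRefine_le A N x
    have htop : ∀ᶠ y in 𝓝[A] x, N y = ⊤ := by
      filter_upwards [h1] with y hy
      refine Submodule.eq_top_of_finrank_eq (le_antisymm (Submodule.finrank_le _) ?_)
      exact hdim.trans hy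
    filter_upwards [eventually_eventually_nhdsWithin.2 htop, self_mem_nhdsWithin] with y hy hyA
    have hR : glaeserRefine A N y = N y := by
      rw [glaeserRefine_congr hyA (N' := fun _ => ⊤) hy, hy.self_of_nhdsWithin hyA]
      refine eq_top_iff.2 fun v _ => ⟨trivial, fun ε hε => Eventually.of_forall fun z =>
        ⟨v, trivial, by simpa⟩⟩
    have hR' : ∀ᶠ z in 𝓝[A] y, glaeserRefine A N z = N z := by
      filter_upwards [eventually_eventually_nhdsWithin.2 hy, self_mem_nhdsWithin] with z hz hzA
      rw [glaeserRefine_congr hzA (N' := fun _ => ⊤) hz, hz.self_of_nhdsWithin hzA]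
      refine eq_top_iff.2 fun v _ => ⟨trivial, fun ε hε => Eventually.of_forall fun z =>
        ⟨v, trivial, by simpa⟩⟩
    exact glaeserRefine_congr hyA hR'
  | succ k ih =>
    intro x hx hdim l hl
    have mono := fun y => glaeserIter_antitone A N y
    by_cases hcase : finrank ℝ V ≤ finrank ℝ (glaeserIter A N (2 * k + 1) x) + k
    · rw [ih x hx hcase l (by omega), ih x hx hcase (2 * (k + 1) + 1) (by omega)]
    have hge := finrank_glaeserRefine_le A (glaeserIter A N (2 * k + 2)) x
    have hloc : ∀ᶠ y in 𝓝[A] x,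
        glaeserIter A N (2 * k + 1 + 1) y = glaeserIter A N (2 * k + 1) y := by
      filter_upwards [hge, self_mem_nhdsWithin] with y hy hyA
      by_cases hy' : finrank ℝ V ≤ finrank ℝ (glaeserIter A N (2 * k + 1) y) + k
      · exact ih y hyA hy' _ (by omega)
      · refine Submodule.eq_of_le_of_finrank_le (mono y (Nat.le_succ _)) ?_
        have h3 : finrank ℝ V ≤
            finrank ℝ (glaeserRefine A (glaeserIter A N (2 * k + 2)) x) + (k + 1) := hdim
        have h4 : finrank ℝ (glaeserRefine A (glaeserIter A N (2 * k + 2)) x) ≤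
          finrank ℝ (glaeserIter A N (2 * k + 1 + 1) y) := hy
        omega
    rw [glaeserIter_eq_of_eventually hx hloc (by omega : 2 * k + 1 ≤ l),
      glaeserIter_eq_of_eventually hx hloc (by omega : 2 * k + 1 ≤ 2 * (k + 1) + 1)]

/-- **Glaeser's stabilization lemma**: over `A`, the refinements are stationary after
`2 dim V + 1` steps. -/
theorem glaeserIter_stable [FiniteDimensional ℝ V] (A : Set X) (N : X → Submodule ℝ V) {x : X}
    (hx : x ∈ A) : glaeserIter A N (2 * finrank ℝ V + 1 + 1) x =
      glaeserIter A N (2 * finrank ℝ V + 1) x :=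
  glaeserIter_eq_of_finrank A N _ x hx (Nat.le_add_left _ _) _ (Nat.le_succ _)

end BundleRefinement

section Smoothing

open Set Filter Topology MeasureTheory Module
open scoped Convolution ContDiff

variable {E : Type*} [NormedAddCommGroup E] [NormedSpace ℝ E]

/-- A function which is `C¹` off a closed set `A` and strictly differentiable at each point of `A`
is `C¹`. -/
theorem contDiff_one_of_hasStrictFDerivAt {A : Set E} (hA : IsClosed A) {f : E → ℝ}
    (hoff : ContDiffOn ℝ 1 f Aᶜ) (hon : ∀ a ∈ A, ∃ l : E →L[ℝ] ℝ, HasStrictFDerivAt f l a) :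
    ContDiff ℝ 1 f := by
  have hnhds : ∀ x, x ∉ A → Aᶜ ∈ 𝓝 x := fun x hx => hA.isOpen_compl.mem_nhds hx
  have hdiff : Differentiable ℝ f := fun x => by
    by_cases hx : x ∈ A
    · obtain ⟨l, hl⟩ := hon x hx
      exact hl.hasFDerivAt.differentiableAt
    · exact (hoff.contDiffAt (hnhds x hx)).differentiableAt one_ne_zero
  rw [contDiff_one_iff_fderiv]
  refine ⟨hdiff, continuous_iff_continuousAt.2 fun x => ?_⟩
  by_cases hx : x ∈ A
  · obtain ⟨l, hl⟩ := hon x hx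
    rw [ContinuousAt, hl.hasFDerivAt.fderiv, Metric.tendsto_nhds]
    intro ε hε
    obtain ⟨T, hT, hlin⟩ := hl.approximates_deriv_on_nhds (c := ⟨ε / 2, (half_pos hε).le⟩)
      (Or.inr (half_pos hε))
    filter_upwards [eventually_mem_nhds_iff.2 hT] with y hy
    have hfy : HasFDerivAt (fun z => f z - l z) (fderiv ℝ f y - l) y :=
      (hdiff y).hasFDerivAt.sub l.hasFDerivAt
    rw [dist_eq_norm]
    refine (hfy.le_of_lip' (half_pos hε).le ?_).trans_lt (half_lt_self hε)
    filter_upwards [hy] with z hz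
    have := hlin z hz y (mem_of_mem_nhds hy)
    rw [map_sub] at this
    rwa [sub_sub_sub_comm] at this
  · exact ((hoff.contDiffAt (hnhds x hx)).fderiv_right (m := 0) (by simp)).continuousAt

variable [FiniteDimensional ℝ E]

section VariableAverage

variable [MeasurableSpace E] [BorelSpace E]

/-- Averages of a continuous function over balls of smoothly varying radius are smooth. -/
theorem contDiffOn_variable_average (μ : Measure E) [μ.IsAddHaarMeasure]
    (φ : ContDiffBump (0 : E)) {U s : E → ℝ} {Ω : Set E} (hU : Continuous U)
    (hs : ContDiff ℝ 1 s) (hsΩ : ∀ x ∈ Ω, 0 < s x) (hs1 : ∀ x, s x ≤ 1) :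
    ContDiffOn ℝ 1 (fun x => ∫ z, φ.normed μ z * U (x + s x • z) ∂μ) Ω := by
  let k : ℝ → E → ℝ := fun p w => (p ^ finrank ℝ E)⁻¹ * φ.normed μ (-(p⁻¹ • w))
  have hk : ContDiffOn ℝ 1 (fun q : ℝ × E => (U ⋆[ContinuousLinearMap.mul ℝ ℝ, μ] k q.1) q.2)
      (Ioo 0 2 ×ˢ univ) := by
    refine contDiffOn_convolution_right_with_param (n := 1) _ isOpen_Ioo
      (isCompact_closedBall (0 : E) (2 * φ.rOut)) ?_ hU.locallyIntegrable ?_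
    · rintro p x ⟨hp0, hp2⟩ hx
      have : -(p⁻¹ • x) ∉ Function.support (φ.normed μ) := by
        rw [φ.support_normed_eq, Metric.mem_ball, dist_zero_right, norm_neg, norm_smul, norm_inv,
          Real.norm_of_nonneg hp0.le, not_lt, inv_mul_eq_div, le_div_iff₀ hp0]
        rw [Metric.mem_closedBall, dist_zero_right, not_le] at hx
        nlinarith [φ.rOut_pos]
      simp only [k]
      rw [Function.notMem_support.1 this, mul_zero]
    · have h1 : ContDiffOn ℝ 1 (fun q : ℝ × E => (q.1)⁻¹) (Ioo 0 2 ×ˢ univ) :=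
        contDiffOn_fst.inv fun q hq => hq.1.1.ne'
      have h2 : ContDiffOn ℝ 1 (fun q : ℝ × E => (q.1 ^ finrank ℝ E)⁻¹) (Ioo 0 2 ×ˢ univ) :=
        (contDiffOn_fst.pow _).inv fun q hq => (pow_pos hq.1.1 _).ne'
      exact h2.mul ((φ.contDiff_normed (n := 1)).comp_contDiffOn (h1.smul contDiffOn_snd).neg)
  have hcomp := hk.comp (s := Ω) (f := fun x => (s x, x)) (hs.prodMk contDiff_id).contDiffOn
    fun x hx => ⟨⟨hsΩ x hx, (hs1 x).trans_lt (by norm_num)⟩, mem_univ _⟩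
  refine hcomp.congr fun x hx => ?_
  have hp := hsΩ x hx
  have e1 : ∀ z, φ.normed μ z * U (x + s x • z) =
      (fun w => φ.normed μ ((s x)⁻¹ • w) * U (x + w)) (s x • z) := fun z => by
    simp only [smul_smul, inv_mul_cancel₀ hp.ne', one_smul]
  simp only [Function.comp_apply, convolution_def, ContinuousLinearMap.mul_apply']
  rw [integral_congr_ae (Eventually.of_forall e1), Measure.integral_comp_smul μ
    (fun w => φ.normed μ ((s x)⁻¹ • w) * U (x + w)) (s x),
    ← integral_add_left_eq_self (μ := μ) (fun t => U t * k (s x) (x - t)) x, smul_eq_mul,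
    ← integral_const_mul]
  congr 1
  ext w
  simp only [k]
  rw [abs_of_pos (inv_pos.2 (pow_pos hp _))]
  have : -((s x)⁻¹ • (x - (x + w))) = (s x)⁻¹ • w := by
    rw [← smul_neg]; congr 1; abel
  rw [this]
  ring

theorem hasStrictFDerivAt_variable_average (μ : Measure E) [μ.IsAddHaarMeasure]
    (φ : ContDiffBump (0 : E)) (hφ : φ.rOut ≤ 1) {U s : E → ℝ} (hU : Continuous U) {a : E}
    {l : E →L[ℝ] ℝ} (hl : HasStrictFDerivAt U l a) (hs0 : ∀ x, 0 ≤ s x) (hsa : s a = 0)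
    (hs : HasStrictFDerivAt s (0 : E →L[ℝ] ℝ) a) :
    HasStrictFDerivAt (fun x => ∫ z, φ.normed μ z * U (x + s x • z) ∂μ) l a := by
  rw [hasStrictFDerivAt_iff_isLittleO, Asymptotics.isLittleO_iff]
  intro ε hε
  obtain ⟨T, hT, hlin⟩ := hl.approximates_deriv_on_nhds (c := ⟨ε / 3, by positivity⟩)
      (Or.inr (div_pos hε three_pos))
  obtain ⟨δ, hδ, hball⟩ := Metric.mem_nhds_iff.1 hT
  have hmem : ∀ᶠ x in 𝓝 a, ∀ z, ‖z‖ ≤ 1 → x + s x • z ∈ T := by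
    have hc : ContinuousAt (fun x => ‖x - a‖ + s x) a :=
      (continuousAt_id.sub continuousAt_const).norm.add hs.hasFDerivAt.continuousAt
    filter_upwards [hc.eventually (gt_mem_nhds (by simpa [hsa] using hδ))] with x hx z hz
    refine hball ?_
    rw [Metric.mem_ball, dist_eq_norm, add_sub_right_comm]
    refine (norm_add_le _ _).trans_lt (lt_of_le_of_lt ?_ hx)
    rw [norm_smul, Real.norm_of_nonneg (hs0 x)]
    nlinarith [hs0 x]
  have hsε : 0 < min 1 (ε / 3 / (‖l‖ + 1)) := by positivity
  have hs' := hs.isLittleO.def hsε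
  rw [nhds_prod_eq] at hs' ⊢
  filter_upwards [hs', hmem.prod_mk hmem] with ⟨x, y⟩ hxy ⟨hx, hy⟩
  simp only [zero_apply, sub_zero] at hxy hx hy ⊢
  have hUint : ∀ x, Integrable (fun z => φ.normed μ z * U (x + s x • z)) μ := fun x =>
    Continuous.integrable_of_hasCompactSupport
      (φ.continuous_normed.mul (hU.comp (by fun_prop))) φ.hasCompactSupport_normed.mul_right
  have hone : Integrable (φ.normed μ) μ := φ.integrable_normed
  have hsplit : (∫ z, φ.normed μ z * U (x + s x • z) ∂μ) - (∫ z, φ.normed μ z * U (y + s y • z) ∂μ)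
      - l (x - y) = ∫ z, φ.normed μ z * (U (x + s x • z) - U (y + s y • z) - l (x - y)) ∂μ := by
    have : l (x - y) = ∫ z, φ.normed μ z * l (x - y) ∂μ := by
      rw [integral_mul_const, φ.integral_normed, one_mul]
    rw [← integral_sub (hUint x) (hUint y)]
    conv_lhs => rw [this]
    have hxyint : Integrable (fun z => φ.normed μ z * U (x + s x • z) -
      φ.normed μ z * U (y + s y • z)) μ := (hUint x).sub (hUint y)
    rw [← integral_sub hxyint (hone.mul_const _)]
    congr 1
    ext z
    ring
  rw [hsplit]
  have hbound : ∀ z, ‖φ.normed μ z * (U (x + s x • z) - U (y + s y • z) - l (x - y))‖ ≤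
      φ.normed μ z * (ε * ‖x - y‖) := by
    intro z
    have hφ0 : 0 ≤ φ.normed μ z := φ.nonneg_normed z
    by_cases hz : z ∈ Function.support (φ.normed μ)
    swap
    · rw [Function.notMem_support.1 hz]; simp
    rw [φ.support_normed_eq, Metric.mem_ball, dist_zero_right] at hz
    have hz1 : ‖z‖ ≤ 1 := hz.le.trans hφ
    rw [norm_mul, Real.norm_of_nonneg hφ0]
    refine mul_le_mul_of_nonneg_left ?_ hφ0
    have h1 := hlin _ (hx z hz1) _ (hy z hz1)
    have e1 : x + s x • z - (y + s y • z) = (x - y) + (s x - s y) • z := by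
      rw [sub_smul]; abel
    rw [e1, map_add, map_smul] at h1
    have h1' : ‖U (x + s x • z) - U (y + s y • z) - (l (x - y) + (s x - s y) • l z)‖ ≤
      ε / 3 * ‖x - y + (s x - s y) • z‖ := h1
    have h2 : ‖(s x - s y) • z‖ ≤ ‖s x - s y‖ := by
      rw [norm_smul]
      exact mul_le_of_le_one_right (norm_nonneg _) hz1
    have h3 : ‖(s x - s y) • l z‖ ≤ ‖s x - s y‖ * ‖l‖ := by
      rw [norm_smul]
      exact mul_le_mul_of_nonneg_left ((l.le_opNorm z).trans
        (mul_le_of_le_one_right (norm_nonneg _) hz1)) (norm_nonneg _)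
    have h4 : ‖s x - s y‖ ≤ ‖x - y‖ := hxy.trans
      (mul_le_of_le_one_left (norm_nonneg _) (min_le_left _ _))
    have h5 : ‖s x - s y‖ * ‖l‖ ≤ ε / 3 * ‖x - y‖ := by
      have h6 : ‖s x - s y‖ ≤ ε / 3 / (‖l‖ + 1) * ‖x - y‖ := hxy.trans
        (mul_le_mul_of_nonneg_right (min_le_right _ _) (norm_nonneg _))
      calc ‖s x - s y‖ * ‖l‖ ≤ (ε / 3 / (‖l‖ + 1) * ‖x - y‖) * (‖l‖ + 1) :=
            mul_le_mul h6 (by linarith) (norm_nonneg _) (by positivity)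
        _ = ε / 3 * ‖x - y‖ := by field_simp
    calc ‖U (x + s x • z) - U (y + s y • z) - l (x - y)‖
        = ‖(U (x + s x • z) - U (y + s y • z) - (l (x - y) + (s x - s y) • l z))
            + (s x - s y) • l z‖ := by congr 1; ring
      _ ≤ ε / 3 * (‖x - y‖ + ‖x - y‖) + ε / 3 * ‖x - y‖ :=
          (norm_add_le _ _).trans (add_le_add (h1'.trans (mul_le_mul_of_nonneg_left
            ((norm_add_le _ _).trans (add_le_add le_rfl (h2.trans h4))) (by positivity)))
            (h3.trans h5))
      _ = ε * ‖x - y‖ := by ring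
  refine (norm_integral_le_of_norm_le (hone.mul_const _) (Eventually.of_forall hbound)).trans ?_
  rw [integral_mul_const, φ.integral_normed, one_mul]

end VariableAverage

/-- A continuous function which is strictly differentiable along a closed set `A` agrees to first
order along `A` with a `C¹` function. -/
theorem exists_contDiff_of_hasStrictFDerivAt {A : Set E} (hA : IsClosed A) {U : E → ℝ}
    (hU : Continuous U) {g : E → E →L[ℝ] ℝ} (hg : ∀ a ∈ A, HasStrictFDerivAt U (g a) a) :
    ∃ f : E → ℝ, ContDiff ℝ 1 f ∧ ∀ a ∈ A, f a = U a ∧ HasFDerivAt f (g a) a := by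
  borelize E
  let μ : Measure E := Measure.addHaar
  let φ : ContDiffBump (0 : E) := ⟨1 / 2, 1, by norm_num, by norm_num⟩
  obtain ⟨s, hsupp, hs, hrange⟩ := hA.isOpen_compl.exists_contDiff_support_eq (n := 1)
  have hs01 : ∀ x, 0 ≤ s x ∧ s x ≤ 1 := fun x => hrange (mem_range_self x)
  have hsA : ∀ a ∈ A, s a = 0 := fun a ha => by
    have : a ∉ Function.support s := by rw [hsupp]; exact fun h => h ha
    exact Function.notMem_support.1 this
  have hpos : ∀ x ∈ Aᶜ, 0 < s x := fun x hx => by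
    rw [← hsupp] at hx
    exact (hs01 x).1.lt_of_ne' hx
  have hstrict : ∀ a ∈ A, HasStrictFDerivAt s (0 : E →L[ℝ] ℝ) a := fun a ha => by
    have hmin : IsLocalMin s a := Eventually.of_forall fun x => by
      rw [hsA a ha]; exact (hs01 x).1
    rw [← hmin.fderiv_eq_zero]
    exact hs.contDiffAt.hasStrictFDerivAt one_ne_zero
  have hf : ∀ a ∈ A, HasStrictFDerivAt (fun x => ∫ z, φ.normed μ z * U (x + s x • z) ∂μ) (g a) a :=
    fun a ha => hasStrictFDerivAt_variable_average μ φ le_rfl hU (hg a ha) (fun x => (hs01 x).1)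
      (hsA a ha) (hstrict a ha)
  refine ⟨_, contDiff_one_of_hasStrictFDerivAt hA (contDiffOn_variable_average μ φ hU hs hpos
    fun x => (hs01 x).2) fun a ha => ⟨g a, hf a ha⟩, fun a ha => ⟨?_, (hf a ha).hasFDerivAt⟩⟩
  simp only [hsA a ha, zero_smul, add_zero]
  rw [integral_mul_const, φ.integral_normed, one_mul]

end Smoothing

section WhitneyExtension

open Set Filter Topology

/-- A modulus for a bounded function `Q ≥ 0` on pairs which tends to zero near the diagonal. -/
theorem exists_modulus {X : Type*} [PseudoMetricSpace X] {K : Set X}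
    {Q : X → X → ℝ} {M : ℝ} (hM : 0 ≤ M) (hQ0 : ∀ a ∈ K, ∀ b ∈ K, 0 ≤ Q a b)
    (hQM : ∀ a ∈ K, ∀ b ∈ K, Q a b ≤ M)
    (hQ : ∀ ε > 0, ∃ δ > 0, ∀ a ∈ K, ∀ b ∈ K, dist a b < δ → Q a b ≤ ε) :
    ∃ w : ℝ → ℝ, w 0 = 0 ∧ (∀ s t, 0 ≤ s → 0 ≤ t → w s - w t ≤ 2 * M * |s - t|) ∧
      (∀ a ∈ K, ∀ b ∈ K, dist a b * Q a b ≤ w (dist a b)) ∧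
      ∀ ε > 0, ∃ δ > 0, ∀ s t, 0 ≤ s → s < δ → 0 ≤ t → t < δ → w s - w t ≤ ε * |s - t| := by
  classical
  rcases K.eq_empty_or_nonempty with rfl | ⟨k₀, hk₀⟩
  · refine ⟨fun _ => 0, rfl, fun s t _ _ => by simp; positivity, by simp, fun ε hε =>
      ⟨1, one_pos, fun s t _ _ _ _ => by simp; positivity⟩⟩
  let F : ℝ → K × K → ℝ := fun t p => Q p.1 p.2 * max 0 (2 * t - dist (p.1 : X) p.2)
  have : Nonempty (K × K) := ⟨⟨⟨k₀, hk₀⟩, ⟨k₀, hk₀⟩⟩⟩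
  have hF0 : ∀ t p, 0 ≤ F t p := fun t p =>
    mul_nonneg (hQ0 _ p.1.2 _ p.2.2) (le_max_left _ _)
  have hbdd : ∀ t, BddAbove (range (F t)) := fun t => ⟨M * max 0 (2 * t), by
    rintro _ ⟨p, rfl⟩
    refine mul_le_mul (hQM _ p.1.2 _ p.2.2) (max_le_max le_rfl ?_) (le_max_left _ _) hM
    linarith [dist_nonneg (x := (p.1 : X)) (y := p.2)]⟩
  have hmax : ∀ s t d : ℝ, max 0 (2 * s - d) ≤ max 0 (2 * t - d) + 2 * |s - t| := fun s t d => by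
    have := le_abs_self (s - t)
    have := abs_nonneg (s - t)
    have := le_max_left 0 (2 * t - d)
    have := le_max_right 0 (2 * t - d)
    exact max_le (by linarith) (by linarith)
  have hlip : ∀ s t p L, Q p.1 p.2 ≤ L → F s p ≤ (⨆ q, F t q) + 2 * L * |s - t| := by
    intro s t p L hL
    have h1 := le_ciSup (hbdd t) p
    have h2 : F s p ≤ Q p.1 p.2 * (max 0 (2 * t - dist (p.1 : X) p.2) + 2 * |s - t|) :=
      mul_le_mul_of_nonneg_left (hmax _ _ _) (hQ0 _ p.1.2 _ p.2.2)
    have h3 : Q p.1 p.2 * (2 * |s - t|) ≤ L * (2 * |s - t|) :=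
      mul_le_mul_of_nonneg_right hL (by positivity)
    have h4 : F t p = Q p.1 p.2 * max 0 (2 * t - dist (p.1 : X) p.2) := rfl
    linarith
  refine ⟨fun t => ⨆ p, F t p, ?_, fun s t _ _ => ?_, fun a ha b hb => ?_, fun ε hε => ?_⟩
  · have : ∀ p, F 0 p = 0 := fun p => by simp [F]
    simp [this]
  · rw [sub_le_iff_le_add']
    exact ciSup_le fun p => hlip s t p M (hQM _ p.1.2 _ p.2.2)
  · refine le_trans (le_of_eq ?_) (le_ciSup (hbdd (dist a b)) (⟨a, ha⟩, ⟨b, hb⟩))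
    have : 2 * dist a b - dist a b = dist a b := by ring
    simp only [F]
    rw [this, max_eq_right dist_nonneg, mul_comm]
  · obtain ⟨δ, hδ, h⟩ := hQ (ε / 2) (half_pos hε)
    refine ⟨δ / 2, half_pos hδ, fun s t hs0 hs ht0 ht => ?_⟩
    rw [sub_le_iff_le_add']
    refine ciSup_le fun p => ?_
    by_cases hp : dist (p.1 : X) p.2 < δ
    · refine (hlip s t p (ε / 2) (h _ p.1.2 _ p.2.2 hp)).trans (le_of_eq ?_)
      ring
    · have h0 : F s p = 0 := by
        simp only [F]
        rw [max_eq_left (by linarith), mul_zero]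
      rw [h0]
      exact add_nonneg ((hF0 t p).trans (le_ciSup (hbdd t) p)) (by positivity)

variable {E : Type*} [NormedAddCommGroup E] [NormedSpace ℝ E]

/-- A local Whitney condition on a compact set is uniform. -/
theorem uniform_of_whitney_condition {K : Set E} (hK : IsCompact K) {g : E → E →L[ℝ] ℝ}
    (hW : ∀ x ∈ K, ∀ ε > 0, ∃ δ > 0, ∀ a ∈ K, ∀ b ∈ K, dist a x < δ → dist b x < δ →
      |g a (b - a)| ≤ ε * ‖b - a‖) {ε : ℝ} (hε : 0 < ε) :
    ∃ δ > 0, ∀ a ∈ K, ∀ b ∈ K, dist a b < δ → |g a (b - a)| ≤ ε * ‖b - a‖ := by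
  choose! δ hδ h using fun x hx => hW x hx ε hε
  obtain ⟨r, hr, hball⟩ := lebesgue_number_lemma_of_metric (c := fun x : K => Metric.ball (x : E)
    (δ x)) hK (fun _ => Metric.isOpen_ball) fun x hx =>
      mem_iUnion.2 ⟨⟨x, hx⟩, Metric.mem_ball_self (hδ x hx)⟩
  refine ⟨r, hr, fun a ha b hb hab => ?_⟩
  obtain ⟨x, hx⟩ := hball a ha
  exact h x x.2 a ha b hb (hx (Metric.mem_ball_self hr)) (hx (by rwa [Metric.mem_ball, dist_comm]))

/-- A continuous field of covectors on a compact set which satisfies Whitney's condition for the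
zero function is the strict derivative of a continuous function vanishing on that set. -/
theorem exists_hasStrictFDerivAt_of_whitney {K : Set E} (hK : IsCompact K) (hne : K.Nonempty)
    {g : E → E →L[ℝ] ℝ} (hg : Continuous g)
    (hW : ∀ x ∈ K, ∀ ε > 0, ∃ δ > 0, ∀ a ∈ K, ∀ b ∈ K, dist a x < δ → dist b x < δ →
      |g a (b - a)| ≤ ε * ‖b - a‖) :
    ∃ U : E → ℝ, Continuous U ∧ (∀ a ∈ K, U a = 0) ∧ ∀ a ∈ K, HasStrictFDerivAt U (g a) a := by
  obtain ⟨G, hG⟩ := hK.exists_bound_of_continuousOn hg.continuousOn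
  obtain ⟨k₀, hk₀⟩ := hne
  have hG0 : 0 ≤ G := (norm_nonneg _).trans (hG k₀ hk₀)
  have hdiam : ∀ a ∈ K, ∀ b ∈ K, dist a b ≤ Metric.diam K := fun a ha b hb =>
    Metric.dist_le_diam_of_mem hK.isBounded ha hb
  obtain ⟨w, hw0, hwL, hwQ, hwε⟩ := exists_modulus (K := K)
    (Q := fun a b => |g a (b - a)| / ‖b - a‖ + dist a b) (M := G + Metric.diam K)
    (add_nonneg hG0 Metric.diam_nonneg) (fun a _ b _ => by positivity)
    (fun a ha b hb => add_le_add (div_le_of_le_mul₀ (norm_nonneg _) hG0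
      (((g a).le_opNorm _).trans (mul_le_mul_of_nonneg_right (hG a ha) (norm_nonneg _))))
      (hdiam a ha b hb))
    (fun ε hε => by
      obtain ⟨δ, hδ, h⟩ := uniform_of_whitney_condition hK hW (half_pos hε)
      refine ⟨min δ (ε / 2), lt_min hδ (half_pos hε), fun a ha b hb hab => ?_⟩
      have h1 := div_le_of_le_mul₀ (norm_nonneg _) (half_pos hε).le
        (h a ha b hb (hab.trans_le (min_le_left _ _)))
      have h2 := hab.trans_le (min_le_right _ _)
      linarith)
  let h : E → E → ℝ := fun a x => g a (x - a) + w (dist x a)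
  set L := G + 2 * (G + Metric.diam K) with hL
  have hL0 : 0 ≤ L := by have := Metric.diam_nonneg (s := K); positivity
  have habs : ∀ x y a : E, |dist x a - dist y a| ≤ ‖x - y‖ := fun x y a => by
    rw [← dist_eq_norm]; exact abs_dist_sub_le x y a
  have hlip : ∀ a ∈ K, ∀ x y, h a x - h a y ≤ L * ‖x - y‖ := by
    intro a ha x y
    have h1 := hwL (dist x a) (dist y a) dist_nonneg dist_nonneg
    have h2 : g a (x - a) - g a (y - a) ≤ G * ‖x - y‖ := by
      rw [← map_sub, sub_sub_sub_cancel_right]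
      exact (le_abs_self _).trans (((g a).le_opNorm _).trans
        (mul_le_mul_of_nonneg_right (hG a ha) (norm_nonneg _)))
    have h3 := mul_le_mul_of_nonneg_left (habs x y a)
      (show 0 ≤ 2 * (G + Metric.diam K) by have := Metric.diam_nonneg (s := K); positivity)
    simp only [h, hL]
    linarith
  have hwcont : ContinuousOn w (Ici 0) := by
    have : LipschitzOnWith (2 * (G + Metric.diam K)).toNNReal w (Ici 0) :=
      LipschitzOnWith.of_le_add_mul _ fun s hs t ht => by
        rw [Real.coe_toNNReal _ (by have := Metric.diam_nonneg (s := K); positivity),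
          Real.dist_eq]
        linarith [hwL s t hs ht]
    exact this.continuousOn
  have hmin : ∀ x, ∃ a ∈ K, IsMinOn (fun a => h a x) K a := fun x => by
    refine hK.exists_isMinOn ⟨k₀, hk₀⟩ (ContinuousOn.add ?_ ?_)
    · exact (hg.clm_apply (by fun_prop)).continuousOn
    · exact hwcont.comp (by fun_prop) fun a _ => dist_nonneg
  choose α hα hαmin using hmin
  have hself : ∀ a, h a a = 0 := fun a => by simp [h, hw0]
  have hquad : ∀ a ∈ K, ∀ b ∈ K, dist a b ^ 2 ≤ h a b := by
    intro a ha b hb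
    have h1 := hwQ a ha b hb
    have h2 : dist a b * (|g a (b - a)| / ‖b - a‖) = |g a (b - a)| := by
      rw [dist_comm, dist_eq_norm]
      rcases eq_or_ne b a with rfl | hba
      · simp
      · exact mul_div_cancel₀ _ (norm_ne_zero_iff.2 (sub_ne_zero.2 hba))
    have h3 := neg_abs_le (g a (b - a))
    simp only [h]
    rw [dist_comm b a]
    rw [mul_add, h2] at h1
    nlinarith
  let U : E → ℝ := fun x => h (α x) x
  have hUle : ∀ a ∈ K, ∀ x, U x ≤ h a x := fun a ha x => hαmin x ha
  refine ⟨U, ?_, fun a ha => ?_, fun a₀ ha₀ => ?_⟩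
  · refine (LipschitzWith.of_le_add_mul L.toNNReal fun x y => ?_).continuous
    rw [Real.coe_toNNReal _ hL0, dist_eq_norm]
    have h1 := hUle (α y) (hα y) x
    have h2 := hlip (α y) (hα y) x y
    have h3 : U y = h (α y) y := rfl
    linarith
  · refine le_antisymm ((hUle a ha a).trans_eq (hself a)) ?_
    exact (sq_nonneg _).trans (hquad (α a) (hα a) a ha)
  · rw [hasStrictFDerivAt_iff_isLittleO, Asymptotics.isLittleO_iff]
    intro ε hε
    obtain ⟨δ₁, hδ₁, h₁⟩ := Metric.continuousAt_iff.1 (hg.continuousAt (x := a₀)) (ε / 2)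
      (half_pos hε)
    obtain ⟨δ₂, hδ₂, h₂⟩ := hwε (ε / 2) (half_pos hε)
    set r := min δ₁ (δ₂ / 2) with hr
    have hr0 : 0 < r := lt_min hδ₁ (half_pos hδ₂)
    set ρ := min (δ₂ / 2) (r ^ 2 / (2 * L + 1)) with hρ
    have hρ0 : 0 < ρ := lt_min (half_pos hδ₂) (by positivity)
    have hnear : ∀ y ∈ Metric.ball a₀ ρ, dist (α y) a₀ < r := by
      intro y hy
      rw [Metric.mem_ball, dist_eq_norm] at hy
      have e1 := hquad (α y) (hα y) a₀ ha₀
      have e2 := hlip (α y) (hα y) a₀ y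
      have e3 := hlip a₀ ha₀ y a₀
      have e4 := hUle a₀ ha₀ y
      have e5 : U y = h (α y) y := rfl
      rw [norm_sub_rev] at e2
      rw [hself] at e3
      have e6 : (2 * L + 1) * ρ ≤ r ^ 2 := by
        rw [mul_comm, ← le_div_iff₀ (by positivity)]
        exact min_le_right _ _
      have e7 : L * ‖y - a₀‖ ≤ L * ρ := mul_le_mul_of_nonneg_left hy.le hL0
      refine lt_of_pow_lt_pow_left₀ 2 hr0.le ?_
      linarith
    have key : ∀ x ∈ Metric.ball a₀ ρ, ∀ y ∈ Metric.ball a₀ ρ,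
        U x - U y - g a₀ (x - y) ≤ ε * ‖x - y‖ := by
      intro x hx y hy
      have hay := hnear y hy
      have hd : ∀ z ∈ Metric.ball a₀ ρ, dist z (α y) < δ₂ := fun z hz => by
        have e1 := dist_triangle_right z (α y) a₀
        have e2 : dist z a₀ < δ₂ / 2 := (Metric.mem_ball.1 hz).trans_le (min_le_left _ _)
        have e3 := hay.trans_le (min_le_right δ₁ (δ₂ / 2))
        linarith
      have e1 := h₂ (dist x (α y)) (dist y (α y)) dist_nonneg (hd x hx) dist_nonneg (hd y hy)
      have e2 := mul_le_mul_of_nonneg_left (habs x y (α y)) (half_pos hε).le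
      have e3 : (g (α y) - g a₀) (x - y) ≤ ε / 2 * ‖x - y‖ := by
        refine (le_abs_self _).trans (((g (α y) - g a₀).le_opNorm _).trans
          (mul_le_mul_of_nonneg_right ?_ (norm_nonneg _)))
        rw [← dist_eq_norm]
        exact (h₁ (hay.trans_le (min_le_left _ _))).le
      have e4 := hUle (α y) (hα y) x
      have e5 : U y = h (α y) y := rfl
      have e6 : g (α y) (x - α y) - g (α y) (y - α y) = g (α y) (x - y) := by
        rw [← map_sub, sub_sub_sub_cancel_right]
      rw [sub_apply] at e3
      simp only [h] at e4 e5
      linarith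
    filter_upwards [prod_mem_nhds (Metric.ball_mem_nhds a₀ hρ0) (Metric.ball_mem_nhds a₀ hρ0)]
      with ⟨x, y⟩ ⟨hx, hy⟩
    rw [Real.norm_eq_abs, abs_le]
    refine ⟨?_, key x hx y hy⟩
    have e1 := key y hy x hx
    rw [norm_sub_rev, ← neg_sub x y, map_neg] at e1
    simp only
    linarith

/-- **Whitney's extension theorem** in class `C¹`, for jets of the zero function on a compact
set. -/
theorem exists_contDiff_of_whitney [FiniteDimensional ℝ E] {K : Set E} (hK : IsCompact K)
    (hne : K.Nonempty) {g : E → E →L[ℝ] ℝ} (hg : Continuous g)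
    (hW : ∀ x ∈ K, ∀ ε > 0, ∃ δ > 0, ∀ a ∈ K, ∀ b ∈ K, dist a x < δ → dist b x < δ →
      |g a (b - a)| ≤ ε * ‖b - a‖) :
    ∃ f : E → ℝ, ContDiff ℝ 1 f ∧ ∀ a ∈ K, f a = 0 ∧ HasFDerivAt f (g a) a := by
  obtain ⟨U, hU, hU0, hUg⟩ := exists_hasStrictFDerivAt_of_whitney hK hne hg hW
  obtain ⟨f, hf, hfA⟩ := exists_contDiff_of_hasStrictFDerivAt hK.isClosed hU hUg
  exact ⟨f, hf, fun a ha => ⟨(hfA a ha).1.trans (hU0 a ha), (hfA a ha).2⟩⟩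

end WhitneyExtension

namespace RealStructure

section DefinableSets

variable (S : RealStructure) {n m k : ℕ}

theorem univ_mem : Set.univ ∈ S.defin n := by
  simpa using S.compl_mem (S.empty_mem n)

theorem inter_mem {A B : Set (Fin n → ℝ)} (hA : A ∈ S.defin n) (hB : B ∈ S.defin n) :
    A ∩ B ∈ S.defin n := by
  simpa [Set.compl_union] using S.compl_mem (S.union_mem (S.compl_mem hA) (S.compl_mem hB))

theorem forall_mem {κ : Type*} [Finite κ] {A : κ → Set (Fin n → ℝ)}
    (hA : ∀ i, A i ∈ S.defin n) : {x | ∀ i, x ∈ A i} ∈ S.defin n := by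
  classical
  cases nonempty_fintype κ
  have key : ∀ s : Finset κ, {x | ∀ i ∈ s, x ∈ A i} ∈ S.defin n := fun s => by
    induction s using Finset.induction_on with
    | empty => simpa using S.univ_mem
    | insert i s _ ih =>
      convert S.inter_mem (hA i) ih using 1
      ext x
      simp
  simpa using key Finset.univ

theorem exists_append_mem {A : Set (Fin (n + k) → ℝ)} (hA : A ∈ S.defin (n + k)) :
    {x : Fin n → ℝ | ∃ y : Fin k → ℝ, Fin.append x y ∈ A} ∈ S.defin n := by
  induction k with
  | zero =>
    have happ : ∀ (x : Fin n → ℝ) (y : Fin 0 → ℝ), Fin.append x y = x :=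
      fun x y => funext fun i => Fin.append_left x y i
    have e : {x : Fin n → ℝ | ∃ y : Fin 0 → ℝ, Fin.append x y ∈ A} = A :=
      Set.ext fun x => ⟨fun ⟨y, hy⟩ => happ x y ▸ hy, fun hx => ⟨Fin.elim0, by rwa [happ]⟩⟩
    rw [e]
    exact hA
  | succ k ih =>
    convert ih (S.proj_mem hA) using 1
    ext x
    have key : ∀ (y : Fin k → ℝ) (t : ℝ),
        Fin.append x (Fin.snoc (α := fun _ => ℝ) y t) = Fin.snoc (α := fun _ => ℝ)
          (Fin.append x y) t := fun y t => Fin.append_snoc x y t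
    constructor
    · rintro ⟨y, hy⟩
      refine ⟨Fin.init y, y (Fin.last k), ?_⟩
      rw [← key, Fin.snoc_init_self]
      exact hy
    · rintro ⟨y, t, hy⟩
      refine ⟨Fin.snoc (α := fun _ => ℝ) y t, ?_⟩
      rw [key]
      exact hy

theorem coord_eq_mem (i j : Fin n) : {x : Fin n → ℝ | x i = x j} ∈ S.defin n := by
  convert S.polyEq_mem (MvPolynomial.X i - MvPolynomial.X j) using 1
  ext x
  simp [sub_eq_zero]

theorem reindex_mem {A : Set (Fin n → ℝ)} (hA : A ∈ S.defin n) (f : Fin n → Fin m) :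
    {x : Fin m → ℝ | (fun i => x (f i)) ∈ A} ∈ S.defin m := by
  convert S.exists_append_mem (S.inter_mem (S.prod_mem (S.univ_mem (n := m)) hA)
    (S.forall_mem fun i : Fin n => S.coord_eq_mem (Fin.natAdd m i) (Fin.castAdd n (f i)))) using 1
  ext x
  simp only [Set.mem_ofPred_eq, Set.mem_inter_iff, Fin.append_left, Fin.append_right,
    Set.mem_univ, true_and]
  constructor
  · exact fun h => ⟨_, h, fun i => rfl⟩
  · rintro ⟨y, hy, hyx⟩
    rwa [← funext hyx]

end DefinableSets

/-- A predicate on `ι → ℝ` is definable if all its coordinate substitutions define definable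
sets. -/
def DefinablePred (S : RealStructure) {ι : Type*} (P : (ι → ℝ) → Prop) : Prop :=
  ∀ (m : ℕ) (f : ι → Fin m), {x : Fin m → ℝ | P fun i => x (f i)} ∈ S.defin m

namespace DefinablePred

variable {S : RealStructure} {ι κ : Type*} {P Q : (ι → ℝ) → Prop}

theorem not (hP : S.DefinablePred P) : S.DefinablePred fun z => ¬ P z :=
  fun m f => S.compl_mem (hP m f)

theorem and (hP : S.DefinablePred P) (hQ : S.DefinablePred Q) :
    S.DefinablePred fun z => P z ∧ Q z :=
  fun m f => S.inter_mem (hP m f) (hQ m f)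

theorem or (hP : S.DefinablePred P) (hQ : S.DefinablePred Q) :
    S.DefinablePred fun z => P z ∨ Q z :=
  fun m f => S.union_mem (hP m f) (hQ m f)

theorem congr (hP : S.DefinablePred P) (h : ∀ z, Q z ↔ P z) : S.DefinablePred Q := by
  rwa [show Q = P from funext fun z => propext (h z)]

theorem imp (hP : S.DefinablePred P) (hQ : S.DefinablePred Q) :
    S.DefinablePred fun z => P z → Q z :=
  (hP.not.or hQ).congr fun _ => imp_iff_not_or

theorem forall_finite [Finite κ] {P : κ → (ι → ℝ) → Prop} (hP : ∀ i, S.DefinablePred (P i)) :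
    S.DefinablePred fun z => ∀ i, P i z :=
  fun m f => S.forall_mem fun i => hP i m f

theorem comp (hP : S.DefinablePred P) (f : ι → κ) :
    S.DefinablePred fun z : κ → ℝ => P fun i => z (f i) :=
  fun m g => hP m fun i => g (f i)

theorem mem {n : ℕ} {A : Set (Fin n → ℝ)} (hA : A ∈ S.defin n) (f : Fin n → ι) :
    S.DefinablePred fun z => (fun i => z (f i)) ∈ A :=
  fun _ g => S.reindex_mem hA fun i => g (f i)

theorem exists_vec {n : ℕ} {P : (ι → ℝ) → (Fin n → ℝ) → Prop}
    (hP : S.DefinablePred fun z : ι ⊕ Fin n → ℝ =>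
      P (fun i => z (Sum.inl i)) (fun i => z (Sum.inr i))) :
    S.DefinablePred fun z => ∃ y, P z y := by
  intro m f
  convert S.exists_append_mem
    (hP (m + n) (Sum.elim (fun i => Fin.castAdd n (f i)) (Fin.natAdd m))) using 1
  ext x
  simp

theorem exists_real {P : (ι → ℝ) → ℝ → Prop}
    (hP : S.DefinablePred fun z : ι ⊕ Unit → ℝ => P (fun i => z (Sum.inl i)) (z (Sum.inr ()))) :
    S.DefinablePred fun z => ∃ t, P z t := by
  have h : S.DefinablePred fun z => ∃ y : Fin 1 → ℝ, P z (y 0) :=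
    exists_vec (hP.comp (Sum.map id fun _ => (0 : Fin 1)))
  exact h.congr fun z => ⟨fun ⟨t, ht⟩ => ⟨fun _ => t, ht⟩, fun ⟨y, hy⟩ => ⟨y 0, hy⟩⟩

theorem forall_vec {n : ℕ} {P : (ι → ℝ) → (Fin n → ℝ) → Prop}
    (hP : S.DefinablePred fun z : ι ⊕ Fin n → ℝ =>
      P (fun i => z (Sum.inl i)) (fun i => z (Sum.inr i))) :
    S.DefinablePred fun z => ∀ y, P z y :=
  (exists_vec (P := fun z y => ¬ P z y) hP.not).not.congr fun _ => not_exists_not.symm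

theorem forall_real {P : (ι → ℝ) → ℝ → Prop}
    (hP : S.DefinablePred fun z : ι ⊕ Unit → ℝ => P (fun i => z (Sum.inl i)) (z (Sum.inr ()))) :
    S.DefinablePred fun z => ∀ t, P z t :=
  (exists_real (P := fun z y => ¬ P z y) hP.not).not.congr fun _ => not_exists_not.symm

theorem poly_pos (p : MvPolynomial ι ℝ) : S.DefinablePred fun z => 0 < MvPolynomial.eval z p :=
  fun m f => by
    convert S.polyLt_mem (MvPolynomial.rename f p) using 1
    ext x
    rw [Set.mem_ofPred_eq, Set.mem_ofPred_eq, MvPolynomial.eval_rename]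
    rfl

end DefinablePred

/-- Polynomial functions on `ι → ℝ`. -/
def IsPolynomialFun {ι : Type*} (t : (ι → ℝ) → ℝ) : Prop :=
  ∃ p : MvPolynomial ι ℝ, ∀ z, MvPolynomial.eval z p = t z

namespace IsPolynomialFun

variable {ι κ : Type*} {t u : (ι → ℝ) → ℝ}

theorem coord (i : ι) : IsPolynomialFun fun z : ι → ℝ => z i := ⟨MvPolynomial.X i, by simp⟩

theorem const (c : ℝ) : IsPolynomialFun fun _ : ι → ℝ => c := ⟨MvPolynomial.C c, by simp⟩

theorem sub (ht : IsPolynomialFun t) (hu : IsPolynomialFun u) :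
    IsPolynomialFun fun z => t z - u z := by
  obtain ⟨p, hp⟩ := ht
  obtain ⟨q, hq⟩ := hu
  exact ⟨p - q, by simp [hp, hq]⟩

theorem mul (ht : IsPolynomialFun t) (hu : IsPolynomialFun u) :
    IsPolynomialFun fun z => t z * u z := by
  obtain ⟨p, hp⟩ := ht
  obtain ⟨q, hq⟩ := hu
  exact ⟨p * q, by simp [hp, hq]⟩

theorem sum [Fintype κ] {t : κ → (ι → ℝ) → ℝ} (ht : ∀ i, IsPolynomialFun (t i)) :
    IsPolynomialFun fun z => ∑ i, t i z := by
  choose p hp using ht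
  exact ⟨∑ i, p i, by simp [hp]⟩

end IsPolynomialFun

namespace DefinablePred

variable {S : RealStructure} {ι : Type*} {t u : (ι → ℝ) → ℝ}

theorem lt (ht : IsPolynomialFun t) (hu : IsPolynomialFun u) :
    S.DefinablePred fun z => t z < u z := by
  obtain ⟨p, hp⟩ := hu.sub ht
  exact (poly_pos p).congr fun z => by rw [hp, sub_pos]

theorem le (ht : IsPolynomialFun t) (hu : IsPolynomialFun u) :
    S.DefinablePred fun z => t z ≤ u z :=
  (lt hu ht).not.congr fun _ => not_lt.symm

theorem eq (ht : IsPolynomialFun t) (hu : IsPolynomialFun u) :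
    S.DefinablePred fun z => t z = u z :=
  ((le ht hu).and (le hu ht)).congr fun _ => le_antisymm_iff

theorem abs_le (ht : IsPolynomialFun t) (hu : IsPolynomialFun u) :
    S.DefinablePred fun z => |t z| ≤ u z := by
  refine ((le ht hu).and (le ((IsPolynomialFun.const 0).sub ht) hu)).congr fun z => ?_
  rw [abs_le', zero_sub]

theorem dist_lt {n : ℕ} (f g : Fin n → ι) (hu : IsPolynomialFun u) :
    S.DefinablePred fun z => dist (fun i => z (f i)) (fun i => z (g i)) < u z := by
  have h1 : ∀ i, S.DefinablePred fun z => dist (z (f i)) (z (g i)) < u z := fun i => by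
    have e := (IsPolynomialFun.coord (f i)).sub (IsPolynomialFun.coord (g i))
    refine ((lt e hu).and (lt ((IsPolynomialFun.const 0).sub e) hu)).congr fun z => ?_
    rw [Real.dist_eq, abs_lt, zero_sub, neg_lt, and_comm]
  refine ((lt (IsPolynomialFun.const 0) hu).and (forall_finite h1)).congr fun z => ?_
  constructor
  · intro h
    have hpos := dist_nonneg.trans_lt h
    exact ⟨hpos, (dist_pi_lt_iff hpos).1 h⟩
  · rintro ⟨hpos, h⟩
    exact (dist_pi_lt_iff hpos).2 h

end DefinablePred

end RealStructure

section ZariskiTangent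

open Set Filter Topology Module

variable {n : ℕ}

/-- The identification of `ℝⁿ` with its dual through the dot product. -/
noncomputable def dotCovector (n : ℕ) : (Fin n → ℝ) ≃L[ℝ] ((Fin n → ℝ) →L[ℝ] ℝ) :=
  ((dotProductEquiv ℝ (Fin n)).trans LinearMap.toContinuousLinearMap).toContinuousLinearEquiv

theorem dotCovector_apply (w v : Fin n → ℝ) : dotCovector n w v = ∑ i, w i * v i := rfl

/-- The covectors annihilating the paratangent cone of `A` at `x`, in metric form. -/
noncomputable def paratangentAnnihilator (A : Set (Fin n → ℝ)) (x : Fin n → ℝ) :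
    Submodule ℝ (Fin n → ℝ) where
  carrier := {w | ∀ ε > 0, ∃ δ > 0, ∀ a ∈ A, ∀ b ∈ A, dist a x < δ → dist b x < δ →
    |dotCovector n w (b - a)| ≤ ε * ‖b - a‖}
  zero_mem' := fun ε hε => ⟨1, one_pos, fun a _ b _ _ _ => by simp; positivity⟩
  add_mem' := by
    intro w w' h h' ε hε
    obtain ⟨δ, hδ, H⟩ := h (ε / 2) (half_pos hε)
    obtain ⟨δ', hδ', H'⟩ := h' (ε / 2) (half_pos hε)
    refine ⟨min δ δ', lt_min hδ hδ', fun a ha b hb hax hbx => ?_⟩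
    have h1 := H a ha b hb (hax.trans_le (min_le_left _ _)) (hbx.trans_le (min_le_left _ _))
    have h2 := H' a ha b hb (hax.trans_le (min_le_right _ _)) (hbx.trans_le (min_le_right _ _))
    have h3 := abs_add_le (dotCovector n w (b - a)) (dotCovector n w' (b - a))
    have e : (dotCovector n w + dotCovector n w') (b - a) =
      dotCovector n w (b - a) + dotCovector n w' (b - a) := rfl
    rw [map_add, e]
    linarith
  smul_mem' := by
    intro c w h ε hε
    have hc : 0 < |c| + 1 := by positivity
    obtain ⟨δ, hδ, H⟩ := h (ε / (|c| + 1)) (div_pos hε hc)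
    refine ⟨δ, hδ, fun a ha b hb hax hbx => ?_⟩
    have h1 := H a ha b hb hax hbx
    rw [map_smul]
    calc |c • dotCovector n w (b - a)| = |c| * |dotCovector n w (b - a)| := abs_mul _ _
      _ ≤ (|c| + 1) * (ε / (|c| + 1) * ‖b - a‖) :=
          mul_le_mul (by linarith) h1 (abs_nonneg _) hc.le
      _ = ε * ‖b - a‖ := by field_simp

theorem mem_paratangentAnnihilator {A : Set (Fin n → ℝ)} {x w : Fin n → ℝ} :
    w ∈ paratangentAnnihilator A x ↔ ∀ ε > 0, ∃ δ > 0, ∀ a ∈ A, ∀ b ∈ A, dist a x < δ →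
      dist b x < δ → |dotCovector n w (b - a)| ≤ ε * ‖b - a‖ := Iff.rfl

/-- The stable Glaeser refinement of the annihilator of the paratangent cone. -/
noncomputable def glaeserConormal (A : Set (Fin n → ℝ)) : (Fin n → ℝ) → Submodule ℝ (Fin n → ℝ) :=
  glaeserIter A (paratangentAnnihilator A) (2 * finrank ℝ (Fin n → ℝ) + 1)

theorem fderiv_mem_glaeserIter {A : Set (Fin n → ℝ)} {f : (Fin n → ℝ) → ℝ} (hf : ContDiff ℝ 1 f)
    (hfA : ∀ x ∈ A, f x = 0) (k : ℕ) : ∀ x ∈ A, (dotCovector n).symm (fderiv ℝ f x) ∈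
      glaeserIter A (paratangentAnnihilator A) k x := by
  induction k with
  | zero =>
    intro x _ ε hε
    have hs := (hf.contDiffAt (x := x)).hasStrictFDerivAt one_ne_zero
    obtain ⟨δ, hδ, H⟩ := Metric.eventually_nhds_iff.1 (hs.isLittleO.def hε)
    refine ⟨δ, hδ, fun a ha b hb hax hbx => ?_⟩
    have := H (y := (b, a)) (max_lt hbx hax)
    simp only [hfA a ha, hfA b hb, sub_self, zero_sub, norm_neg] at this
    rw [ContinuousLinearEquiv.apply_symm_apply]
    exact this
  | succ k ih =>
    intro x hx
    refine ⟨ih x hx, fun ε hε => ?_⟩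
    have hc : Continuous fun y => (dotCovector n).symm (fderiv ℝ f y) :=
      (dotCovector n).symm.continuous.comp (hf.continuous_fderiv one_ne_zero)
    filter_upwards [nhdsWithin_le_nhds (Metric.tendsto_nhds.1 (hc.tendsto x) ε hε),
      self_mem_nhdsWithin] with y hy hyA
    exact ⟨_, ih y hyA, hy⟩

theorem exists_contDiff_of_mem_glaeserConormal {A : Set (Fin n → ℝ)} (hA : IsClosed A)
    {x₀ w₀ : Fin n → ℝ} (hx₀ : x₀ ∈ A) (hw₀ : w₀ ∈ glaeserConormal A x₀) :
    ∃ f : (Fin n → ℝ) → ℝ, ContDiff ℝ 1 f ∧ (∀ x ∈ A, f x = 0) ∧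
      fderiv ℝ f x₀ = dotCovector n w₀ := by
  classical
  let Φ : (Fin n → ℝ) → Set (Fin n → ℝ) := fun y =>
    if y = x₀ then {w₀} else if y ∈ A then glaeserConormal A y else univ
  have hΦx₀ : Φ x₀ = {w₀} := if_pos rfl
  have hΦA : ∀ y ∈ A, Φ y ⊆ glaeserConormal A y := fun y hy w hw => by
    by_cases h : y = x₀
    · subst h
      rw [hΦx₀] at hw
      rwa [mem_singleton_iff.1 hw]
    · have e : Φ y = glaeserConormal A y := by simp only [Φ, if_neg h, if_pos hy]
      rwa [e] at hw
  have hlsc : LowerHemi Φ := by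
    intro x v hv ε hε
    by_cases hx : x ∈ A
    · have hvN := hΦA x hx hv
      rw [SetLike.mem_coe, glaeserConormal, ← glaeserIter_stable A _ hx] at hvN
      have hne : ∀ᶠ y in 𝓝 x, y = x₀ → x = x₀ := by
        by_cases h : x = x₀
        · exact Eventually.of_forall fun _ _ => h
        · filter_upwards [isOpen_ne.mem_nhds h] with y hy hy'
          exact absurd hy' hy
      filter_upwards [hne, eventually_nhdsWithin_iff.1 (hvN.2 ε hε)] with y hy1 hy2
      by_cases hyx : y = x₀
      · obtain rfl := hy1 hyx
        exact ⟨v, by rwa [hyx], by simpa⟩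
      · by_cases hyA : y ∈ A
        · obtain ⟨w, hw, hwv⟩ := hy2 hyA
          exact ⟨w, by simp only [Φ, if_neg hyx, if_pos hyA]; exact hw, hwv⟩
        · exact ⟨v, by simp [Φ, hyx, hyA], by simpa⟩
    · filter_upwards [hA.isOpen_compl.mem_nhds hx] with y hy
      have hyx : y ≠ x₀ := fun h => hy (h ▸ hx₀)
      have hyA : y ∉ A := hy
      exact ⟨v, by simp [Φ, hyx, hyA], by simpa⟩
  have hconv : ∀ y, Convex ℝ (Φ y) := fun y => by
    simp only [Φ]
    split_ifs
    exacts [convex_singleton _, Submodule.convex _, convex_univ]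
  have hne : ∀ y, (Φ y).Nonempty := fun y => by
    simp only [Φ]
    split_ifs
    exacts [singleton_nonempty _, ⟨0, zero_mem _⟩, univ_nonempty]
  have hcl : ∀ y, IsClosed (Φ y) := fun y => by
    simp only [Φ]
    split_ifs
    exacts [isClosed_singleton, Submodule.closed_of_finiteDimensional _, isClosed_univ]
  obtain ⟨g, hg, hgΦ⟩ := hlsc.exists_continuous_selection hconv hne hcl
  have hgx₀ : g x₀ = w₀ := by
    have := hgΦ x₀
    rwa [hΦx₀] at this
  have hgN : ∀ a ∈ A, g a ∈ paratangentAnnihilator A a := fun a ha =>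
    glaeserIter_antitone A _ a (Nat.zero_le _) (hΦA a ha (hgΦ a))
  have hG : Continuous fun y => dotCovector n (g y) := (dotCovector n).continuous.comp hg
  let K := A ∩ Metric.closedBall x₀ 1
  have hK : IsCompact K := (isCompact_closedBall x₀ 1).inter_left hA
  obtain ⟨F, hF, hFK⟩ := exists_contDiff_of_whitney hK
    ⟨x₀, hx₀, Metric.mem_closedBall_self zero_le_one⟩ hG (by
      intro x hx ε hε
      obtain ⟨δ₁, hδ₁, h₁⟩ := hgN x hx.1 (ε / 2) (half_pos hε)
      obtain ⟨δ₂, hδ₂, h₂⟩ := Metric.continuousAt_iff.1 (hG.continuousAt (x := x)) (ε / 2)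
        (half_pos hε)
      refine ⟨min δ₁ δ₂, lt_min hδ₁ hδ₂, fun a ha b hb hax hbx => ?_⟩
      have e1 := h₁ a ha.1 b hb.1 (hax.trans_le (min_le_left _ _))
        (hbx.trans_le (min_le_left _ _))
      have e2 := h₂ (hax.trans_le (min_le_right _ _))
      rw [dist_eq_norm] at e2
      have e3 : |(dotCovector n (g a) - dotCovector n (g x)) (b - a)| ≤ ε / 2 * ‖b - a‖ :=
        (ContinuousLinearMap.le_opNorm _ _).trans
          (mul_le_mul_of_nonneg_right e2.le (norm_nonneg _))
      have e4 : dotCovector n (g a) (b - a) = dotCovector n (g x) (b - a) +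
        (dotCovector n (g a) - dotCovector n (g x)) (b - a) := by rw [sub_apply]; ring
      rw [e4]
      refine (abs_add_le _ _).trans ?_
      linarith)
  let χ : ContDiffBump x₀ := ⟨1 / 2, 1, by norm_num, by norm_num⟩
  refine ⟨fun x => χ x * F x, χ.contDiff.mul hF, fun x hx => ?_, ?_⟩
  · by_cases hxb : x ∈ Metric.closedBall x₀ 1
    · simp [(hFK x ⟨hx, hxb⟩).1]
    · have : χ x = 0 := by
        refine χ.zero_of_le_dist ?_
        rw [Metric.mem_closedBall, not_le] at hxb
        exact hxb.le
      simp [this]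
  · have heq : (fun x => χ x * F x) =ᶠ[𝓝 x₀] F := by
      filter_upwards [χ.eventuallyEq_one] with x hx
      rw [hx]
      simp
    rw [heq.fderiv_eq, ← hgx₀]
    exact (hFK x₀ ⟨hx₀, Metric.mem_closedBall_self zero_le_one⟩).2.fderiv

/-- The Zariski tangent set is the annihilator of the stable Glaeser refinement. -/
theorem mem_zariskiTangentSet_iff {A : Set (Fin n → ℝ)} (hA : IsClosed A) (z : Fin (n + n) → ℝ) :
    z ∈ zariskiTangentSet A ↔ (fun i => z (Fin.castAdd n i)) ∈ A ∧
      ∀ w, w ∈ glaeserConormal A (fun i => z (Fin.castAdd n i)) →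
        ∑ i, w i * z (Fin.natAdd n i) = 0 := by
  refine and_congr_right fun hx => ⟨fun h w hw => ?_, fun h f hf hfA => ?_⟩
  · obtain ⟨f, hf, hfA, hfw⟩ := exists_contDiff_of_mem_glaeserConormal hA hx hw
    have := h f hf hfA
    rwa [hfw] at this
  · have := h _ (fderiv_mem_glaeserIter hf hfA _ _ hx)
    rw [← dotCovector_apply _ fun i => z (Fin.natAdd n i)] at this
    simpa using this

open RealStructure in
theorem definablePred_mem_paratangentAnnihilator (S : RealStructure) {A : Set (Fin n → ℝ)}
    (hA : A ∈ S.defin n) : S.DefinablePred fun z : Fin n ⊕ Fin n → ℝ =>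
      (fun i => z (Sum.inr i)) ∈ paratangentAnnihilator A (fun i => z (Sum.inl i)) := by
  have h : S.DefinablePred fun z : Fin n ⊕ Fin n → ℝ => ∀ ε : ℝ, 0 < ε → ∃ δ : ℝ, 0 < δ ∧
      ∀ a : Fin n → ℝ, ∀ b : Fin n → ℝ, ∀ r : ℝ, a ∈ A → b ∈ A →
        dist a (fun i => z (Sum.inl i)) < δ → dist b (fun i => z (Sum.inl i)) < δ →
        dist b a < r → |∑ i, z (Sum.inr i) * (b i - a i)| ≤ ε * r := by
    refine .forall_real (.imp (.lt (.const 0) (.coord _)) (.exists_real (.and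
      (.lt (.const 0) (.coord _)) (.forall_vec (.forall_vec (.forall_real (.imp (.mem hA _)
      (.imp (.mem hA _) (.imp (.dist_lt _ _ (.coord _)) (.imp (.dist_lt _ _ (.coord _))
      (.imp (.dist_lt _ _ (.coord _)) (.abs_le (.sum fun i => (IsPolynomialFun.coord _).mul
        ((IsPolynomialFun.coord _).sub (.coord _))) (.mul (.coord _) (.coord _))))))))))))))
  refine h.congr fun z => ?_
  rw [mem_paratangentAnnihilator]
  refine forall₂_congr fun ε hε => exists_congr fun δ => and_congr_right fun _ => ?_
  constructor
  · intro H a b r ha hb hax hbx hr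
    refine (H a ha b hb hax hbx).trans (mul_le_mul_of_nonneg_left ?_ hε.le)
    rw [← dist_eq_norm]
    exact hr.le
  · intro H a ha b hb hax hbx
    rw [← div_le_iff₀' hε]
    refine le_of_forall_gt_imp_ge_of_dense fun r hr => ?_
    rw [div_le_iff₀' hε]
    exact H a b r ha hb hax hbx (by rwa [dist_eq_norm])

open RealStructure in
theorem definablePred_mem_glaeserRefine (S : RealStructure) {A : Set (Fin n → ℝ)}
    (hA : A ∈ S.defin n) {N : (Fin n → ℝ) → Submodule ℝ (Fin n → ℝ)}
    (hN : S.DefinablePred fun z : Fin n ⊕ Fin n → ℝ =>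
      (fun i => z (Sum.inr i)) ∈ N (fun i => z (Sum.inl i))) :
    S.DefinablePred fun z : Fin n ⊕ Fin n → ℝ =>
      (fun i => z (Sum.inr i)) ∈ glaeserRefine A N (fun i => z (Sum.inl i)) := by
  have hN' : ∀ {ι : Type} (f g : Fin n → ι), S.DefinablePred fun z : ι → ℝ =>
      (fun i => z (g i)) ∈ N (fun i => z (f i)) := fun f g => hN.comp (Sum.elim f g)
  have h : S.DefinablePred fun z : Fin n ⊕ Fin n → ℝ =>
      (fun i => z (Sum.inr i)) ∈ N (fun i => z (Sum.inl i)) ∧ ∀ ε : ℝ, 0 < ε → ∃ δ : ℝ, 0 < δ ∧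
        ∀ y : Fin n → ℝ, dist y (fun i => z (Sum.inl i)) < δ → y ∈ A → ∃ w : Fin n → ℝ,
          w ∈ N y ∧ dist w (fun i => z (Sum.inr i)) < ε :=
    .and hN (.forall_real (.imp (.lt (.const 0) (.coord _)) (.exists_real (.and
      (.lt (.const 0) (.coord _)) (.forall_vec (.imp (.dist_lt _ _ (.coord _)) (.imp (.mem hA _)
      (.exists_vec (.and (hN' _ _) (.dist_lt _ _ (.coord _)))))))))))
  refine h.congr fun z => ?_
  rw [mem_glaeserRefine]
  simp only [eventually_nhdsWithin_iff, Metric.eventually_nhds_iff, gt_iff_lt]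

theorem definablePred_mem_glaeserConormal (S : RealStructure) {A : Set (Fin n → ℝ)}
    (hA : A ∈ S.defin n) : S.DefinablePred fun z : Fin n ⊕ Fin n → ℝ =>
      (fun i => z (Sum.inr i)) ∈ glaeserConormal A (fun i => z (Sum.inl i)) := by
  have key : ∀ k, S.DefinablePred fun z : Fin n ⊕ Fin n → ℝ => (fun i => z (Sum.inr i)) ∈
      glaeserIter A (paratangentAnnihilator A) k (fun i => z (Sum.inl i)) := fun k => by
    induction k with
    | zero => exact definablePred_mem_paratangentAnnihilator S hA
    | succ k ih => exact definablePred_mem_glaeserRefine S hA ih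
  exact key _

open RealStructure in
theorem zariskiTangentSet_mem_defin (S : RealStructure) {A : Set (Fin n → ℝ)} (hAc : IsClosed A)
    (hA : A ∈ S.defin n) : zariskiTangentSet A ∈ S.defin (n + n) := by
  have h : S.DefinablePred fun z : Fin (n + n) → ℝ => (fun i => z (Fin.castAdd n i)) ∈ A ∧
      ∀ w : Fin n → ℝ, w ∈ glaeserConormal A (fun i => z (Fin.castAdd n i)) →
        ∑ i, w i * z (Fin.natAdd n i) = 0 :=
    .and (.mem hA _) (.forall_vec (.imp
      ((definablePred_mem_glaeserConormal S hA).comp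
        (Sum.elim (fun i => Sum.inl (Fin.castAdd n i)) Sum.inr))
      (.eq (.sum fun i => (IsPolynomialFun.coord _).mul (.coord _)) (.const 0))))
  convert h (n + n) id using 1
  ext z
  exact mem_zariskiTangentSet_iff hAc z

theorem characteristicSet_mem_defin (S : RealStructure) {r : ℕ}
    {X : Fin r → (Fin n → ℝ) → (Fin n → ℝ)} (hX : ∀ j, DefinableFun S (X j))
    {A : Set (Fin n → ℝ)} (hA : A ∈ S.defin n) {T : Set (Fin (n + n) → ℝ)}
    (hT : T ∈ S.defin (n + n)) : {x ∈ A | ∀ j, Fin.append x (X j x) ∈ T} ∈ S.defin n := by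
  have hsum : ∀ z : Fin n ⊕ Fin n → ℝ, (fun i => z (finSumFinEquiv.symm i)) =
      Fin.append (fun i => z (Sum.inl i)) (fun i => z (Sum.inr i)) := fun z => by
    funext i
    refine Fin.addCases (fun i => ?_) (fun i => ?_) i <;>
      simp only [finSumFinEquiv_symm_apply_castAdd, finSumFinEquiv_symm_apply_natAdd,
        Fin.append_left, Fin.append_right]
  have h : S.DefinablePred fun x : Fin n → ℝ => x ∈ A ∧
      ∀ j, ∃ v : Fin n → ℝ, v = X j x ∧ Fin.append x v ∈ T := by
    refine .and (.mem hA id) (.forall_finite fun j => .exists_vec (.and ?_ ?_))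
    · refine (RealStructure.DefinablePred.mem (hX j) finSumFinEquiv.symm).congr fun z => ?_
      simp only [Set.mem_ofPred_eq, finSumFinEquiv_symm_apply_castAdd,
        finSumFinEquiv_symm_apply_natAdd]
    · refine (RealStructure.DefinablePred.mem hT finSumFinEquiv.symm).congr fun z => ?_
      rw [hsum]
  convert h n id using 1
  ext x
  simp

end ZariskiTangent

/-- fixing an o-minimal structure and definable (not necessarily
continuous) vector fields `X₁, …, X_r : ℝⁿ → ℝⁿ`, if `A ⊆ ℝⁿ` is closed and definable
then `TA` is definable, and consequently `char(A) = {x ∈ A : X_j(x) ∈ T_x A ∀ j}` is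
definable. -/
theorem zariskiTangentSet_definable_and_char_definable
    (S : OMinimalStructure) {n r : ℕ}
    (X : Fin r → (Fin n → ℝ) → (Fin n → ℝ))
    (hX : ∀ j, DefinableFun S.toRealStructure (X j))
    (A : Set (Fin n → ℝ)) (hAclosed : IsClosed A) (hA : A ∈ S.defin n) :
    zariskiTangentSet A ∈ S.defin (n + n) ∧
    {x ∈ A | ∀ j, Fin.append x (X j x) ∈ zariskiTangentSet A} ∈ S.defin n := by
  have hT := zariskiTangentSet_mem_defin S.toRealStructure hAclosed hA
  exact ⟨hT, characteristicSet_mem_defin S.toRealStructure hX hA hT⟩
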